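/- If G is a simple graph with n ≥ 3 vertices such that d(u) + d(v) ≥ n for every pair of non-adjacent vertices u, v, then G is Hamiltonian (Ore's theorem). -/

import Mathlib

/-- If no two consecutive entries `a, b` satisfy both `q a` and `p b`, then every link of the list
is counted at most once on the left. -/
lemma List.countP_tail_add_countP_dropLast_le {α : Type*} {p q : α → Bool} {l : List α}
    (h : l.IsChain fun a b ↦ ¬ (p b ∧ q a)) :
    l.tail.countP p + l.dropLast.countP q ≤ l.length - 1 := by
  induction l with
  | nil => simp
  | cons a l ih =>
    cases l with
    | nil => simp
    | cons b l =>
      rw [List.isChain_cons_cons] at h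
      have := ih h.2
      simp only [List.tail_cons, List.dropLast_cons_cons, List.countP_cons, List.length_cons] at *
      grind

namespace SimpleGraph

variable {V : Type*} (G : SimpleGraph V) [DecidableRel G.Adj]

/-- `1` if both arguments are vertices and they are not adjacent, `0` otherwise. -/
def gap : Option V → Option V → ℕ
  | some a, some b => if G.Adj a b then 0 else 1
  | _, _ => 0

/-- The number of consecutive non-adjacent pairs in a list of vertices. -/
def pathGaps : List V → ℕ
  | [] => 0
  | a :: l => G.gap (some a) l.head? + pathGaps l

/-- The number of consecutive non-adjacent pairs in a cyclically ordered list of vertices. -/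
def cycleGaps (l : List V) : ℕ :=
  G.pathGaps l + G.gap l.getLast? l.head?

@[simp] lemma gap_none_left (b : Option V) : G.gap none b = 0 := by
  simp [gap]

@[simp] lemma gap_none_right (a : Option V) : G.gap a none = 0 := by
  cases a <;> simp [gap]

lemma gap_comm (a b : Option V) : G.gap a b = G.gap b a := by
  cases a <;> cases b <;> simp [gap, G.adj_comm]

lemma pathGaps_append (l₁ l₂ : List V) :
    G.pathGaps (l₁ ++ l₂) =
      G.pathGaps l₁ + G.gap l₁.getLast? l₂.head? + G.pathGaps l₂ := by
  induction l₁ with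
  | nil => simp [pathGaps]
  | cons a l ih =>
    cases l with
    | nil => simp [pathGaps]
    | cons b l => simp_all [pathGaps]; omega

lemma pathGaps_reverse (l : List V) : G.pathGaps l.reverse = G.pathGaps l := by
  induction l with
  | nil => rfl
  | cons a l ih =>
    simp [pathGaps, pathGaps_append, ih, gap_comm, add_comm]

lemma pathGaps_eq_zero_iff {l : List V} : G.pathGaps l = 0 ↔ l.IsChain G.Adj := by
  induction l with
  | nil => simp [pathGaps]
  | cons a l ih =>
    cases l with
    | nil => simp [pathGaps]
    | cons b l => simp_all [pathGaps, gap]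

lemma cycleGaps_append_comm (l₁ l₂ : List V) :
    G.cycleGaps (l₁ ++ l₂) = G.cycleGaps (l₂ ++ l₁) := by
  obtain rfl | h₁ := eq_or_ne l₁ []
  · simp
  obtain rfl | h₂ := eq_or_ne l₂ []
  · simp
  simp only [cycleGaps, pathGaps_append, List.head?_append, List.getLast?_append,
    List.head?_eq_some_head h₁, List.head?_eq_some_head h₂,
    List.getLast?_eq_some_getLast h₁, List.getLast?_eq_some_getLast h₂, Option.some_or]
  omega

/-- A cyclic list of vertices with a gap can be rotated so that the gap joins its ends. -/
lemma exists_perm_gap_ends {l : List V} (hl : G.cycleGaps l ≠ 0) :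
    ∃ l' : List V, l'.Perm l ∧ G.cycleGaps l' = G.cycleGaps l ∧
      G.gap l'.getLast? l'.head? = 1 := by
  by_cases h : G.gap l.getLast? l.head? = 0
  · have hc : ¬ l.IsChain G.Adj := by
      rw [← pathGaps_eq_zero_iff]; simpa [cycleGaps, h] using hl
    rw [List.isChain_iff_forall_rel_of_append_cons_cons] at hc
    push Not at hc
    obtain ⟨a, b, l₁, l₂, rfl, hab⟩ := hc
    have hs : l₁ ++ a :: b :: l₂ = (l₁ ++ [a]) ++ (b :: l₂) := by simp
    refine ⟨(b :: l₂) ++ (l₁ ++ [a]), ?_, ?_, ?_⟩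
    · rw [hs]; exact List.perm_append_comm
    · rw [hs, cycleGaps_append_comm]
    · rw [← List.append_assoc, List.getLast?_concat]
      simp [gap, hab]
  · refine ⟨l, .refl _, rfl, ?_⟩
    revert h
    cases l.getLast? <;> cases l.head? <;> simp [gap]

/-- Reversing the end segment of a cyclic list replaces two of its links. -/
lemma cycleGaps_append_reverse {l₁ l₂ : List V} {x a b y : V}
    (hx : l₁.head? = some x) (ha : l₁.getLast? = some a)
    (hb : l₂.head? = some b) (hy : l₂.getLast? = some y) (hyx : ¬ G.Adj y x)
    (hxb : G.Adj x b) (hay : G.Adj a y) :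
    G.cycleGaps (l₁ ++ l₂.reverse) < G.cycleGaps (l₁ ++ l₂) := by
  simp only [cycleGaps, pathGaps_append, pathGaps_reverse, List.head?_append,
    List.getLast?_append, List.head?_reverse, List.getLast?_reverse, hx, ha, hb, hy]
  simp [gap, hyx, hay, hxb.symm]

lemma countP_adj_eq_degree [Fintype V] [DecidableEq V] {l : List V} (hl : l.Nodup) {x : V}
    (h : ∀ v, G.Adj x v → v ∈ l) : l.countP (fun v ↦ decide (G.Adj x v)) = G.degree x := by
  rw [← G.card_neighborFinset_eq_degree, List.countP_eq_length_filter,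
    ← List.toFinset_card_of_nodup (hl.filter _)]
  congr 1
  ext v
  simpa using h v

lemma isHamiltonian_of_cycleGaps_eq_zero [Fintype V] [DecidableEq V]
    (hn : 3 ≤ Fintype.card V) {l : List V} (hl : l.Nodup) (hmem : ∀ v, v ∈ l)
    (h : G.cycleGaps l = 0) : G.IsHamiltonian := by
  have hlen : l.length = Fintype.card V := by
    rw [← List.toFinset_card_of_nodup hl, ← Finset.card_univ]
    congr 1
    ext v
    simp [hmem]
  have hne : l ≠ [] := by rintro rfl; simp at hlen; omega
  obtain ⟨hc, he⟩ := Nat.add_eq_zero_iff.mp h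
  rw [pathGaps_eq_zero_iff] at hc
  rw [List.getLast?_eq_some_getLast hne, List.head?_eq_some_head hne] at he
  have hadj : G.Adj (l.getLast hne) (l.head hne) := by simpa [gap] using he
  let p := Walk.ofSupport l hne hc
  have hp : p.support = l := Walk.support_ofSupport hne hc
  have hpath : p.IsPath := .mk' (hp.symm ▸ hl)
  have hplen : p.length = l.length - 1 := Walk.length_ofSupport hne hc
  refine fun _ ↦ ⟨_, .cons hadj p, ?_⟩
  rw [Walk.isHamiltonianCycle_iff_isCycle_and_length_eq]
  refine ⟨?_, by rw [Walk.length_cons]; omega⟩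
  refine (Walk.cons_isCycle_iff _ _).2 ⟨hpath, fun he ↦ ?_⟩
  rw [Sym2.eq_swap] at he
  have := hpath.length_eq_one_of_mem_edges he
  omega

end SimpleGraph

/-- Ore's theorem: if `G` is a simple graph with `n ≥ 3` vertices such that
`d(u) + d(v) ≥ n` for every pair of distinct non-adjacent vertices `u, v`,
then `G` is Hamiltonian. -/
theorem ore_theorem {V : Type*} [Fintype V] [DecidableEq V]
    (G : SimpleGraph V) [DecidableRel G.Adj]
    (hn : 3 ≤ Fintype.card V)
    (h : ∀ u v : V, u ≠ v → ¬ G.Adj u v →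
      Fintype.card V ≤ G.degree u + G.degree v) :
    G.IsHamiltonian := by
  suffices H : ∀ m, ∀ l : List V, l.Perm Finset.univ.toList → G.cycleGaps l = m →
      G.IsHamiltonian from H _ _ (.refl _) rfl
  intro m
  induction m using Nat.strong_induction_on with
  | _ m ih =>
  intro l hl hm
  by_cases h0 : G.cycleGaps l = 0
  · exact G.isHamiltonian_of_cycleGaps_eq_zero hn (hl.nodup_iff.2 (Finset.nodup_toList _))
      (fun v ↦ hl.mem_iff.2 (by simp)) h0
  obtain ⟨l', hl', hg, he⟩ := G.exists_perm_gap_ends h0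
  have hperm := hl'.trans hl
  have hlen : l'.length = Fintype.card V := by simpa using hperm.length_eq
  have hnd : l'.Nodup := hperm.nodup_iff.2 (Finset.nodup_toList _)
  have hmem (v : V) : v ∈ l' := hperm.mem_iff.2 (by simp)
  have hne : l' ≠ [] := by rintro rfl; simp at hlen; omega
  have hhead := List.head?_eq_some_head hne
  have hlast := List.getLast?_eq_some_getLast hne
  set x := l'.head hne
  set y := l'.getLast hne
  have hyx : ¬ G.Adj y x := by
    intro hyx
    simp [hhead, hlast, SimpleGraph.gap, hyx] at he
  have hx : l' = x :: l'.tail := (List.cons_head_tail hne).symm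
  have hy : l' = l'.dropLast ++ [y] := (List.dropLast_append_getLast hne).symm
  have hxy : x ≠ y := by
    intro hxy
    have hy' : y ∈ l'.tail := by
      have : l'.tail ≠ [] := by
        intro h'; rw [h'] at hx; rw [hx] at hlen; simp at hlen; omega
      have := List.getLast_mem this
      rwa [List.getLast_tail] at this
    rw [hx] at hnd
    exact (List.nodup_cons.1 hnd).1 (hxy ▸ hy')
  have hdeg := h x y hxy (fun e ↦ hyx e.symm)
  have hc : ¬ l'.IsChain fun a b ↦ ¬ (decide (G.Adj x b) ∧ decide (G.Adj y a)) := by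
    intro hc
    have := List.countP_tail_add_countP_dropLast_le
      (p := fun v ↦ decide (G.Adj x v)) (q := fun v ↦ decide (G.Adj y v)) hc
    rw [G.countP_adj_eq_degree hnd.tail, G.countP_adj_eq_degree
      (hnd.sublist (List.dropLast_sublist _))] at this
    · omega
    · intro v hv
      have := hmem v
      rw [hy] at this
      simpa [hv.ne'] using this
    · intro v hv
      have := hmem v
      rw [hx] at this
      simpa [hv.ne'] using this
  rw [List.isChain_iff_forall_rel_of_append_cons_cons] at hc
  push Not at hc
  obtain ⟨a, b, l₁, l₂, hs, hxb, hya⟩ := hc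
  have hs' : l' = (l₁ ++ [a]) ++ (b :: l₂) := by simp [hs]
  refine ih _ ?_ ((l₁ ++ [a]) ++ (b :: l₂).reverse) ?_ rfl
  · rw [← hm, ← hg, hs']
    refine G.cycleGaps_append_reverse (x := x) (a := a) (y := y) ?_ (by simp) rfl ?_ hyx
      (by simpa using hxb) (by simpa using of_decide_eq_true hya |>.symm)
    · rw [← hhead, hs]; cases l₁ <;> simp
    · rw [← hlast, hs', List.getLast?_append_of_ne_nil _ (List.cons_ne_nil _ _)]
  · refine .trans ?_ hperm
    rw [hs']
    exact (List.reverse_perm _).append_left _
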